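/- (Termination of Engel's algorithm.) Start from the critical loading (c(i) = rᵢ − 1 for each transient state i ≠ u, c(u) = r_u, and c(j) = 0 for each absorbing j, counting chips only on transient states) and run Engel's algorithm according to the Engel rules. Then after a finite, positive number of moves the configuration restricted to the transient states is again the critical loading; i.e., the critical loading recurs and the algorithm halts. -/

import Mathlib

/-- A move in Engel's chip game: a type-1 move fires the transient state `i`,
a type-2 move adds a single chip at the distinguished starting state. -/
inductive EngelMove (s : ℕ) where
  | type1 (i : Fin s) : EngelMove s
  | type2 : EngelMove s
deriving DecidableEq

/-- The effect of a move on a configuration of chips: a type-1 move at `i` removes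
`ri i` chips from `i` and sends `rij i j` chips to each state `j`; a type-2 move adds
one chip at the distinguished state `u`. -/
def engelApply {s : ℕ} (u : Fin s) (ri : Fin s → ℕ) (rij : Fin s → Fin s → ℕ) :
    EngelMove s → (Fin s → ℕ) → (Fin s → ℕ)
  | .type1 i, c => fun j => c j - (if j = i then ri i else 0) + rij i j
  | .type2, c => fun j => c j + (if j = u then 1 else 0)

/-- Legality of a move in a configuration (`r` = number of transient states):
a type-1 move at `i` is legal iff `i` is transient and carries at least `ri i` chips;
type-2 moves are always allowed. -/
def engelLegal {s : ℕ} (r : ℕ) (ri : Fin s → ℕ) :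
    EngelMove s → (Fin s → ℕ) → Prop
  | .type1 i, c => (i : ℕ) < r ∧ ri i ≤ c i
  | .type2, _ => True

/-- A list of moves is a legal sequence from a configuration if every type-1 move in it
is legal in the configuration at which it is performed. -/
def engelLegalSeq {s : ℕ} (r : ℕ) (u : Fin s) (ri : Fin s → ℕ)
    (rij : Fin s → Fin s → ℕ) : (Fin s → ℕ) → List (EngelMove s) → Prop
  | _, [] => True
  | c, m :: ms => engelLegal r ri m c ∧
      engelLegalSeq r u ri rij (engelApply u ri rij m c) ms

/-- The configuration obtained after performing a list of moves. -/
def engelRun {s : ℕ} (u : Fin s) (ri : Fin s → ℕ) (rij : Fin s → Fin s → ℕ)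
    (c : Fin s → ℕ) (ms : List (EngelMove s)) : Fin s → ℕ :=
  ms.foldl (fun c m => engelApply u ri rij m c) c

open Finset

/-- The transient states `0, …, r - 1`. -/
def engelTransient (r s : ℕ) : Finset (Fin s) := univ.filter fun i => (i : ℕ) < r

theorem mem_engelTransient {r s : ℕ} {i : Fin s} : i ∈ engelTransient r s ↔ (i : ℕ) < r := by
  simp [engelTransient]

/-- A set of transient states that no positive transition leaves is empty. -/
theorem no_closed_transient_state {r s : ℕ} {rij : Fin s → Fin s → ℕ}
    (habsorbing : ∀ i : Fin s, (i : ℕ) < r →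
      ∃ (m : ℕ) (f : ℕ → Fin s), f 0 = i ∧ (∀ k < m, 0 < rij (f k) (f (k + 1))) ∧
        r ≤ ((f m : Fin s) : ℕ))
    {N : Finset (Fin s)} (hN : N ⊆ engelTransient r s)
    (hclosed : ∀ i ∈ N, ∀ j, 0 < rij i j → j ∈ N) : N = ∅ := by
  refine eq_empty_of_forall_notMem fun i hi => ?_
  obtain ⟨m, f, h0, hpos, hm⟩ := habsorbing i (mem_engelTransient.1 (hN hi))
  have hmem : ∀ k ≤ m, f k ∈ N := by
    intro k
    induction k with
    | zero => intro _; rwa [h0]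
    | succ k ih => exact fun hk => hclosed _ (ih (by omega)) _ (hpos k (by omega))
  have := mem_engelTransient.1 (hN (hmem m le_rfl))
  omega

/-- A weight on the transient states whose inflow never exceeds its outflow is nonnegative. -/
theorem nonneg_of_inflow_le_outflow {r s : ℕ} {ri : Fin s → ℕ} {rij : Fin s → Fin s → ℕ}
    (hsum : ∀ i : Fin s, (i : ℕ) < r → ∑ j, rij i j = ri i)
    (habsorbing : ∀ i : Fin s, (i : ℕ) < r →
      ∃ (m : ℕ) (f : ℕ → Fin s), f 0 = i ∧ (∀ k < m, 0 < rij (f k) (f (k + 1))) ∧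
        r ≤ ((f m : Fin s) : ℕ))
    {z : Fin s → ℚ}
    (hz : ∀ j ∈ engelTransient r s, ∑ i ∈ engelTransient r s, z i * rij i j ≤ z j * ri j) :
    ∀ i ∈ engelTransient r s, 0 ≤ z i := by
  set T := engelTransient r s with hT
  set N := T.filter fun i => z i < 0 with hN
  have hNT : N ⊆ T := filter_subset _ _
  have hneg : ∀ i ∈ N, z i < 0 := fun i hi => (mem_filter.1 hi).2
  have hout : ∀ i ∈ N, (∑ j ∈ N, (rij i j : ℚ)) + ∑ j ∈ Nᶜ, (rij i j : ℚ) = ri i := by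
    intro i hi
    rw [sum_add_sum_compl, ← hsum i (mem_engelTransient.1 (hNT hi))]
    push_cast
    rfl
  have htotal : ∑ i ∈ N, z i * ∑ j ∈ N, (rij i j : ℚ) ≤ ∑ i ∈ N, z i * ri i :=
    calc ∑ i ∈ N, z i * ∑ j ∈ N, (rij i j : ℚ)
        ≤ ∑ i ∈ T, z i * ∑ j ∈ N, (rij i j : ℚ) := by
          refine sum_le_sum_of_subset_of_nonneg hNT fun i hi hiN => ?_
          have : 0 ≤ z i := by
            by_contra h
            exact hiN (mem_filter.2 ⟨hi, not_le.1 h⟩)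
          positivity
      _ = ∑ j ∈ N, ∑ i ∈ T, z i * rij i j := by
          simp_rw [mul_sum]
          exact sum_comm
      _ ≤ ∑ j ∈ N, z j * ri j := sum_le_sum fun j hj => hz j (hNT hj)
  have hleak : 0 ≤ ∑ i ∈ N, z i * ∑ j ∈ Nᶜ, (rij i j : ℚ) := by
    have : ∑ i ∈ N, z i * ri i = ∑ i ∈ N, z i * ∑ j ∈ N, (rij i j : ℚ) +
        ∑ i ∈ N, z i * ∑ j ∈ Nᶜ, (rij i j : ℚ) := by
      rw [← sum_add_distrib]
      exact sum_congr rfl fun i hi => by rw [← hout i hi, mul_add]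
    linarith
  have hterm : ∀ i ∈ N, z i * ∑ j ∈ Nᶜ, (rij i j : ℚ) ≤ 0 := fun i hi =>
    mul_nonpos_of_nonpos_of_nonneg (hneg i hi).le (sum_nonneg fun _ _ => by positivity)
  have hzero := (sum_eq_zero_iff_of_nonpos hterm).1 (le_antisymm (sum_nonpos hterm) hleak)
  have hempty : N = ∅ := by
    refine no_closed_transient_state habsorbing hNT fun i hi j hij => ?_
    by_contra hj
    have h := (mul_eq_zero.1 (hzero i hi)).resolve_left (hneg i hi).ne
    rw [sum_eq_zero_iff_of_nonneg fun _ _ => by positivity] at h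
    have := h j (mem_compl.2 hj)
    norm_cast at this
    omega
  intro i hi
  by_contra h
  have : i ∈ N := mem_filter.2 ⟨hi, not_le.1 h⟩
  simp [hempty] at this

/-- A weight on the transient states whose inflow is never below its outflow is nonpositive. -/
theorem nonpos_of_outflow_le_inflow {r s : ℕ} {ri : Fin s → ℕ} {rij : Fin s → Fin s → ℕ}
    (hsum : ∀ i : Fin s, (i : ℕ) < r → ∑ j, rij i j = ri i)
    (habsorbing : ∀ i : Fin s, (i : ℕ) < r →
      ∃ (m : ℕ) (f : ℕ → Fin s), f 0 = i ∧ (∀ k < m, 0 < rij (f k) (f (k + 1))) ∧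
        r ≤ ((f m : Fin s) : ℕ))
    {z : Fin s → ℚ}
    (hz : ∀ j ∈ engelTransient r s, z j * ri j ≤ ∑ i ∈ engelTransient r s, z i * rij i j) :
    ∀ i ∈ engelTransient r s, z i ≤ 0 := by
  intro i hi
  have := nonneg_of_inflow_le_outflow hsum habsorbing (z := -z)
    (fun j hj => by simpa [sum_neg_distrib] using hz j hj) i hi
  simpa using this

/-- Finitely many nonnegative rationals have a common positive denominator. -/
theorem exists_common_denominator {ι : Type*} [Fintype ι] (T : Finset ι) (w : ι → ℚ)
    (hw : ∀ i ∈ T, 0 ≤ w i) :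
    ∃ (t : ℕ) (x : ι → ℕ), 0 < t ∧ ∀ i ∈ T, (x i : ℚ) = t * w i := by
  refine ⟨∏ i, (w i).den, fun i => ((∏ i, (w i).den : ℕ) * w i).num.toNat,
    prod_pos fun i _ => (w i).den_pos, fun i hi => ?_⟩
  obtain ⟨k, hk⟩ := dvd_prod_of_mem (fun i => (w i).den) (mem_univ i)
  have hnum : ((∏ i, (w i).den : ℕ) : ℚ) * w i = ((k * (w i).num : ℤ) : ℚ) := by
    rw [hk]
    push_cast
    linear_combination (k : ℚ) * Rat.den_mul_eq_num (w i)
  have hnn : 0 ≤ (w i).num := Rat.num_nonneg.2 (hw i hi)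
  dsimp only
  rw [hnum, Rat.num_intCast, ← Int.cast_natCast, Int.toNat_of_nonneg (by positivity)]

/-- Some positive number of chips added at `u` is exactly balanced by firing each transient
state a suitable number of times. -/
theorem exists_balanced_firing {r s : ℕ} (u : Fin s) {ri : Fin s → ℕ} {rij : Fin s → Fin s → ℕ}
    (hsum : ∀ i : Fin s, (i : ℕ) < r → ∑ j, rij i j = ri i)
    (habsorbing : ∀ i : Fin s, (i : ℕ) < r →
      ∃ (m : ℕ) (f : ℕ → Fin s), f 0 = i ∧ (∀ k < m, 0 < rij (f k) (f (k + 1))) ∧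
        r ≤ ((f m : Fin s) : ℕ)) :
    ∃ (t : ℕ) (x : Fin s → ℕ), 0 < t ∧ ∀ j ∈ engelTransient r s,
      (x j : ℚ) * ri j = (if j = u then (t : ℚ) else 0) +
        ∑ i ∈ engelTransient r s, (x i : ℚ) * rij i j := by
  set T := engelTransient r s with hT
  let L : (Fin s → ℚ) →ₗ[ℚ] (Fin s → ℚ) :=
    { toFun := fun z j => if j ∈ T then z j * ri j - ∑ i ∈ T, z i * rij i j else z j
      map_add' := fun a b => by
        ext j
        by_cases hj : j ∈ T
        · simp [hj, add_mul, sum_add_distrib]; ring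
        · simp [hj]
      map_smul' := fun a b => by
        ext j
        by_cases hj : j ∈ T
        · simp [hj, mul_sub, mul_sum, mul_assoc]
        · simp [hj] }
  have hL : ∀ z j, L z j = if j ∈ T then z j * ri j - ∑ i ∈ T, z i * rij i j else z j :=
    fun _ _ => rfl
  have hinj : Function.Injective L := by
    rw [injective_iff_map_eq_zero]
    intro z hz
    have hLz : ∀ j ∈ T, z j * ri j = ∑ i ∈ T, z i * rij i j := by
      intro j hj
      have := congrFun hz j
      rw [hL, if_pos hj, Pi.zero_apply] at this
      linarith
    ext j
    by_cases hj : j ∈ T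
    · exact le_antisymm
        (nonpos_of_outflow_le_inflow hsum habsorbing (fun i hi => (hLz i hi).le) j hj)
        (nonneg_of_inflow_le_outflow hsum habsorbing (fun i hi => (hLz i hi).ge) j hj)
    · simpa [hL, hj] using congrFun hz j
  obtain ⟨w, hw⟩ := LinearMap.surjective_of_injective hinj (Pi.single u 1)
  have hbal : ∀ j ∈ T, w j * ri j = (if j = u then 1 else 0) + ∑ i ∈ T, w i * rij i j := by
    intro j hj
    have := congrFun hw j
    rw [hL, if_pos hj, Pi.single_apply] at this
    linarith
  have hwnn : ∀ i ∈ T, 0 ≤ w i := by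
    refine nonneg_of_inflow_le_outflow hsum habsorbing fun j hj => ?_
    rw [hbal j hj]
    split_ifs <;> linarith
  obtain ⟨t, x, ht, hx⟩ := exists_common_denominator T w hwnn
  refine ⟨t, x, ht, fun j hj => ?_⟩
  rw [hx j hj, mul_assoc, hbal j hj, mul_add, mul_sum]
  congr 1
  · simp
  · exact sum_congr rfl fun i hi => by rw [hx i hi, mul_assoc]

/-- The number of times the move `a` occurs among the first `n` moves of `m`. -/
def engelCount {s : ℕ} (m : ℕ → EngelMove s) (a : EngelMove s) (n : ℕ) : ℕ :=
  ∑ k ∈ range n, if m k = a then 1 else 0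

theorem engelCount_zero {s : ℕ} (m : ℕ → EngelMove s) (a : EngelMove s) :
    engelCount m a 0 = 0 := rfl

theorem engelCount_succ {s : ℕ} (m : ℕ → EngelMove s) (a : EngelMove s) (n : ℕ) :
    engelCount m a (n + 1) = engelCount m a n + if m n = a then 1 else 0 :=
  sum_range_succ _ _

section Run

variable {r s : ℕ} {u : Fin s} {ri : Fin s → ℕ} {rij : Fin s → Fin s → ℕ}
  {m : ℕ → EngelMove s} {c : ℕ → Fin s → ℕ}

/-- The configuration is determined by the initial one and the move counts. -/
theorem engel_config_eq
    (hstep : ∀ n : ℕ, c (n + 1) = engelApply u ri rij (m n) (c n))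
    (hlegal : ∀ n : ℕ, engelLegal r ri (m n) (c n)) (n : ℕ) (j : Fin s) :
    (c n j : ℚ) = c 0 j + (if j = u then (engelCount m .type2 n : ℚ) else 0)
      - (engelCount m (.type1 j) n : ℚ) * ri j
      + ∑ i ∈ engelTransient r s, (engelCount m (.type1 i) n : ℚ) * rij i j := by
  induction n with
  | zero => simp [engelCount_zero]
  | succ n ih =>
    have hl := hlegal n
    rw [hstep n]
    cases hm : m n with
    | type1 i =>
      rw [hm] at hl
      have hi : i ∈ engelTransient r s := mem_engelTransient.2 hl.1
      have hle : (if j = i then ri i else 0) ≤ c n j := by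
        split_ifs with h
        · exact h ▸ hl.2
        · exact Nat.zero_le _
      simp only [engelApply, engelCount_succ, hm, EngelMove.type1.injEq, reduceCtorEq, if_false,
        add_zero]
      push_cast [Nat.cast_sub hle]
      simp only [add_mul, sum_add_distrib, ite_mul, one_mul, zero_mul, sum_ite_eq, hi, if_true, ih]
      by_cases h : j = i
      · subst h; simp; ring
      · simp [h, Ne.symm h]; ring
    | type2 =>
      simp only [engelApply, engelCount_succ, hm, reduceCtorEq, if_false, add_zero, if_true]
      push_cast
      rw [ih]
      split_ifs <;> ring

/-- Every move is either a type-2 move or fires a transient state. -/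
theorem engelCount_total (hlegal : ∀ n : ℕ, engelLegal r ri (m n) (c n)) (n : ℕ) :
    ∑ i ∈ engelTransient r s, engelCount m (.type1 i) n + engelCount m .type2 n = n := by
  induction n with
  | zero => simp [engelCount_zero]
  | succ n ih =>
    have hl := hlegal n
    simp only [engelCount_succ, sum_add_distrib]
    cases hm : m n with
    | type1 i =>
      rw [hm] at hl
      have hi : i ∈ engelTransient r s := mem_engelTransient.2 hl.1
      simp [hi]
      omega
    | type2 =>
      simp
      omega

end Run

/-- **termination of Engel's algorithm.** Start from the critical
loading (`crit i = rᵢ - 1` for transient `i ≠ u`, `crit u = r_u`, no chips on absorbing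
states) and run Engel's algorithm according to the Engel rules (each move is legal, and
a type-2 move is performed only when no type-1 move is legal). Then after a finite,
positive number of moves the configuration restricted to the transient states is again
the critical loading: the critical loading recurs and the algorithm halts. -/
theorem engel_critical_loading_recurs
    (r s : ℕ) (hr : 1 ≤ r) (hrs : r < s)
    (u : Fin s) (hu : (u : ℕ) < r)
    (ri : Fin s → ℕ) (hri : ∀ i : Fin s, (i : ℕ) < r → 0 < ri i)
    (rij : Fin s → Fin s → ℕ)
    (hsum : ∀ i : Fin s, (i : ℕ) < r → ∑ j, rij i j = ri i)
    (habsorbing : ∀ i : Fin s, (i : ℕ) < r →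
      ∃ (m : ℕ) (f : ℕ → Fin s), f 0 = i ∧ (∀ k < m, 0 < rij (f k) (f (k + 1))) ∧
        r ≤ ((f m : Fin s) : ℕ))
    (crit : Fin s → ℕ)
    (hcrit1 : ∀ i : Fin s, (i : ℕ) < r → i ≠ u → crit i = ri i - 1)
    (hcrit2 : crit u = ri u)
    (hcrit3 : ∀ j : Fin s, r ≤ (j : ℕ) → crit j = 0)
    (m : ℕ → EngelMove s) (c : ℕ → (Fin s → ℕ))
    (hc0 : c 0 = crit)
    (hstep : ∀ n : ℕ, c (n + 1) = engelApply u ri rij (m n) (c n))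
    (hlegal : ∀ n : ℕ, engelLegal r ri (m n) (c n))
    (hrule : ∀ n : ℕ, m n = EngelMove.type2 →
      ∀ i : Fin s, ¬ engelLegal r ri (EngelMove.type1 i) (c n)) :
    ∃ n : ℕ, 0 < n ∧ ∀ i : Fin s, (i : ℕ) < r → c n i = crit i := by
  set T := engelTransient r s with hT
  obtain ⟨t, x, ht, hx⟩ := exists_balanced_firing u hsum habsorbing
  have hstart : ∀ j ∈ T, (c 0 j : ℚ) = ri j - 1 + if j = u then 1 else 0 := by
    intro j hj
    rw [hc0]
    split_ifs with h
    · rw [h, hcrit2]; ring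
    · have hj' := mem_engelTransient.1 hj
      rw [hcrit1 j hj' h, Nat.cast_sub (hri j hj')]
      simp
  have hconf : ∀ n, ∀ j ∈ T, (c n j : ℚ) = ri j - 1
      - (if j = u then (t : ℚ) - (engelCount m .type2 n + 1) else 0)
      + ((x j : ℚ) - engelCount m (.type1 j) n) * ri j
      - ∑ i ∈ T, ((x i : ℚ) - engelCount m (.type1 i) n) * rij i j := by
    intro n j hj
    rw [engel_config_eq hstep hlegal n j, hstart j hj]
    simp only [sub_mul, sum_sub_distrib, hx j hj]
    split_ifs <;> ring
  by_contra! hno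
  have hbound : ∀ n, engelCount m .type2 n + 1 ≤ t ∧
      ∀ i ∈ T, engelCount m (.type1 i) n ≤ x i := by
    intro n
    induction n with
    | zero => exact ⟨ht, fun i _ => Nat.zero_le _⟩
    | succ n ih =>
      obtain ⟨ih2, ih1⟩ := ih
      have hl := hlegal n
      cases hm : m n with
      | type1 i =>
        rw [hm] at hl
        have hi : i ∈ T := mem_engelTransient.2 hl.1
        refine ⟨by simpa [engelCount_succ, hm] using ih2, fun j hj => ?_⟩
        rw [engelCount_succ, hm]
        by_cases hji : i = j
        · subst hji
          rw [if_pos rfl]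
          by_contra hgt
          have heq : engelCount m (.type1 i) n = x i := by have := ih1 i hi; omega
          have hci := hconf n i hi
          rw [heq, sub_self, zero_mul] at hci
          have hin : 0 ≤ ∑ k ∈ T, ((x k : ℚ) - engelCount m (.type1 k) n) * rij k i :=
            sum_nonneg fun k hk => mul_nonneg
              (sub_nonneg.2 (by exact_mod_cast ih1 k hk)) (by positivity)
          have hle : (ri i : ℚ) ≤ c n i := by exact_mod_cast hl.2
          have htq : (engelCount m .type2 n : ℚ) + 1 ≤ t := by exact_mod_cast ih2
          split_ifs at hci <;> linarith
        · simpa [hji] using ih1 j hj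
      | type2 =>
        refine ⟨?_, fun j hj => by simpa [engelCount_succ, hm] using ih1 j hj⟩
        rw [engelCount_succ, hm, if_pos rfl]
        by_contra hgt
        have heq : (engelCount m .type2 n : ℚ) + 1 = t := by
          exact_mod_cast (by omega : engelCount m .type2 n + 1 = t)
        have hconf' : ∀ j ∈ T, (c n j : ℚ) = ri j - 1
            + ((x j : ℚ) - engelCount m (.type1 j) n) * ri j
            - ∑ i ∈ T, ((x i : ℚ) - engelCount m (.type1 i) n) * rij i j := by
          intro j hj
          simpa [heq] using hconf n j hj
        have hstable : ∀ j ∈ T, (c n j : ℚ) + 1 ≤ ri j := by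
          intro j hj
          have : c n j < ri j := not_le.1 fun h => hrule n hm j ⟨mem_engelTransient.1 hj, h⟩
          exact_mod_cast this
        have hz := nonpos_of_outflow_le_inflow hsum habsorbing
          (z := fun i => (x i : ℚ) - engelCount m (.type1 i) n) fun j hj => by
            have h1 := hconf' j hj
            have h2 := hstable j hj
            linarith
        have hz0 : ∀ i ∈ T, (x i : ℚ) - engelCount m (.type1 i) n = 0 := fun i hi =>
          le_antisymm (hz i hi) (sub_nonneg.2 (by exact_mod_cast ih1 i hi))
        obtain ⟨j, hj, hne⟩ := hno (n + 1) n.succ_pos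
        have hjT : j ∈ T := mem_engelTransient.2 hj
        apply hne
        have hcj := hconf' j hjT
        rw [hz0 j hjT, sum_eq_zero fun i hi => by rw [hz0 i hi, zero_mul]] at hcj
        have h0 := hstart j hjT
        rw [hc0] at h0
        have : (c (n + 1) j : ℚ) = crit j := by
          rw [hstep n, hm, h0]
          simp only [engelApply]
          push_cast
          rw [hcj]
          ring
        exact_mod_cast this
  have htotal := engelCount_total hlegal (∑ i ∈ T, x i + t)
  rw [← hT] at htotal
  have h1 := sum_le_sum (hbound (∑ i ∈ T, x i + t)).2
  have h2 := (hbound (∑ i ∈ T, x i + t)).1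
  omega
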